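/- Ramanujan's evaluation of the Rogers–Ramanujan continued fraction at q = e^{−2π}: the convergents of the continued fraction 1/(1 + e^{−2π}/(1 + e^{−4π}/(1 + e^{−6π}/(1 + ···)))), i.e., the generalized continued fraction with leading term 0, all partial denominators equal to 1, and partial numerators a₁ = 1, a_k = e^{−2π(k−1)} for k ≥ 2, converge to ( √((5 + √5)/2) − (√5 + 1)/2 ) · e^{2π/5}. -/

import Mathlib

open Real Filter

/-- Partial numerators of the Rogers–Ramanujan continued fraction at `q = e^{-2π}`:
`a₁ = 1` and `a_k = e^{-2π(k-1)}` for `k ≥ 2`. -/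
noncomputable def rrCFa (k : ℕ) : ℝ :=
  if k = 1 then 1 else Real.exp (-2 * π * (k - 1 : ℝ))

/-- Numerators `A_k` (shifted: `rrCFNum (k+1) = A_k`, `rrCFNum 0 = A_{-1} = 1`)
for the continued fraction with leading term `b₀ = 0`, all partial denominators
`b_k = 1`, and partial numerators `rrCFa`. -/
noncomputable def rrCFNum : ℕ → ℝ
  | 0 => 1
  | 1 => 0
  | (k + 2) => 1 * rrCFNum (k + 1) + rrCFa (k + 1) * rrCFNum k

/-- Denominators `B_k` (shifted: `rrCFDen (k+1) = B_k`, `rrCFDen 0 = B_{-1} = 0`). -/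
noncomputable def rrCFDen : ℕ → ℝ
  | 0 => 0
  | 1 => 1
  | (k + 2) => 1 * rrCFDen (k + 1) + rrCFa (k + 1) * rrCFDen k

/-- The exponent `n (5 n + 1) / 2` of the theta series, as a natural number. -/
def rrExp (n : ℕ) : ℕ := 5 * n.choose 2 + 3 * n

lemma rrExp_succ (n : ℕ) : rrExp (n + 1) = rrExp n + 5 * n + 3 := by
  simp only [rrExp, Nat.choose_succ_succ' n 1, Nat.choose_one_right]
  ring

lemma two_mul_rrExp (n : ℕ) : 2 * (rrExp n : ℝ) = n * (5 * n + 1) := by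
  simp only [rrExp, Nat.cast_add, Nat.cast_mul, Nat.cast_choose_two]
  push_cast
  ring

/-- The finite product `(q ^ (n + 1); q)_j`. -/
noncomputable def rrPoch (q : ℝ) (j n : ℕ) : ℝ := ∏ i ∈ Finset.range j, (1 - q ^ (n + 1 + i))

lemma rrPoch_succ (q : ℝ) (j n : ℕ) :
    rrPoch q (j + 1) n = rrPoch q j n * (1 - q ^ (n + 1 + j)) :=
  Finset.prod_range_succ _ _

lemma rrPoch_succ_left (q : ℝ) (j n : ℕ) :
    rrPoch q (j + 1) n = rrPoch q j (n + 1) * (1 - q ^ (n + 1)) := by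
  rw [rrPoch, Finset.prod_range_succ', rrPoch]
  congr 1
  exact Finset.prod_congr rfl fun i _ => by ring

lemma rrPoch_mem_Icc {q : ℝ} (hq0 : 0 ≤ q) (hq1 : q ≤ 1) (j n : ℕ) :
    rrPoch q j n ∈ Set.Icc (0 : ℝ) 1 := by
  have h (i : ℕ) : 0 ≤ 1 - q ^ (n + 1 + i) := sub_nonneg.2 (pow_le_one₀ hq0 hq1)
  exact ⟨Finset.prod_nonneg fun i _ => h i,
    Finset.prod_le_one (fun i _ => h i) fun i _ => sub_le_self _ (pow_nonneg hq0 _)⟩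

/-- The common shape of all series in the Rogers–Ramanujan recurrence. -/
noncomputable def rrTerm (q : ℝ) (j a b n : ℕ) : ℝ :=
  (-1) ^ n * q ^ (rrExp n + a * n) * rrPoch q j n * (1 - q ^ b)

lemma abs_rrTerm_le {q : ℝ} (hq0 : 0 ≤ q) (hq1 : q ≤ 1) (j a b n : ℕ) :
    |rrTerm q j a b n| ≤ q ^ n := by
  obtain ⟨h0, h1⟩ := rrPoch_mem_Icc hq0 hq1 j n
  have h2 : 0 ≤ 1 - q ^ b := sub_nonneg.2 (pow_le_one₀ hq0 hq1)
  have h3 : 1 - q ^ b ≤ 1 := sub_le_self _ (pow_nonneg hq0 _)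
  have h4 : q ^ (rrExp n + a * n) ≤ q ^ n :=
    pow_le_pow_of_le_one hq0 hq1 (by unfold rrExp; nlinarith [Nat.zero_le (a * n)])
  rw [rrTerm, abs_mul, abs_mul, abs_mul, abs_pow, abs_neg, abs_one, one_pow, one_mul,
    abs_of_nonneg h0, abs_of_nonneg h2, abs_of_nonneg (pow_nonneg hq0 _)]
  calc _ ≤ q ^ n * 1 * 1 := by gcongr
    _ = q ^ n := by ring

lemma summable_rrTerm {q : ℝ} (hq0 : 0 ≤ q) (hq1 : q < 1) (j a : ℕ) (b : ℕ → ℕ) :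
    Summable fun n => rrTerm q j a (b n) n :=
  (summable_geometric_of_lt_one hq0 hq1).of_norm_bounded
    fun n => abs_rrTerm_le hq0 hq1.le j a (b n) n

lemma tendsto_rrTerm {q : ℝ} (hq0 : 0 ≤ q) (hq1 : q < 1) (j a : ℕ) (b : ℕ → ℕ) :
    Tendsto (fun n => rrTerm q j a (b n) n) atTop (nhds 0) :=
  (summable_rrTerm hq0 hq1 j a b).tendsto_atTop_zero

lemma tsum_eq_tsum_of_telescoping {f g X : ℕ → ℝ} (hf : Summable f) (hg : Summable g)
    (hX : Tendsto X atTop (nhds 0)) (hX0 : X 0 = 0) (h : ∀ n, f n - g n = X n - X (n + 1)) :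
    ∑' n, f n = ∑' n, g n := by
  have h1 := (hf.hasSum.sub hg.hasSum).tendsto_sum_nat
  simp only [h, Finset.sum_range_sub', hX0, zero_sub] at h1
  have h2 := tendsto_nhds_unique h1 hX.neg
  linarith

/-- The series `∑ (-1)^n q^(n(5n+1)/2 + 2jn) (1 - q^(2(j+1+2n))) (q^(n+1); q)_j`, which is
`(q; q)_∞` times the Rogers–Ramanujan function `∑ q^(n² + jn) / (q; q)_n`. -/
noncomputable def rrSeries (q : ℝ) (j : ℕ) : ℝ := ∑' n, rrTerm q j (2 * j) (2 * (j + 1 + 2 * n)) n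

lemma rrSeries_succ {q : ℝ} (hq0 : 0 ≤ q) (hq1 : q < 1) (j : ℕ) :
    rrSeries q (j + 1) = ∑' n, rrTerm q j (2 * j + 1) (j + 1 + 2 * n) n := by
  symm
  refine tsum_eq_tsum_of_telescoping (X := fun n => rrTerm q j (2 * j + 1) n n)
    (summable_rrTerm hq0 hq1 _ _ _) (summable_rrTerm hq0 hq1 _ _ _)
    (tendsto_rrTerm hq0 hq1 _ _ _) (by simp [rrTerm]) fun n => ?_
  have h1 : rrPoch q j (n + 1) * (1 - q ^ (n + 1)) = rrPoch q j n * (1 - q ^ (n + 1 + j)) := by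
    rw [← rrPoch_succ_left, rrPoch_succ]
  simp only [rrTerm, rrPoch_succ, rrExp_succ]
  rw [mul_assoc _ (rrPoch q j (n + 1)), h1]
  ring

lemma rrSeries_eq_add {q : ℝ} (hq0 : 0 ≤ q) (hq1 : q < 1) (j : ℕ) :
    rrSeries q j = rrSeries q (j + 1) + q ^ (j + 1) * rrSeries q (j + 2) := by
  rw [rrSeries_succ hq0 hq1, rrSeries_succ hq0 hq1, ← tsum_mul_left,
    ← (summable_rrTerm hq0 hq1 _ _ _).tsum_add ((summable_rrTerm hq0 hq1 _ _ _).mul_left _)]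
  refine tsum_eq_tsum_of_telescoping (X := fun n => rrTerm q j (2 * j) n n)
    (summable_rrTerm hq0 hq1 _ _ _)
    ((summable_rrTerm hq0 hq1 _ _ _).add ((summable_rrTerm hq0 hq1 _ _ _).mul_left _))
    (tendsto_rrTerm hq0 hq1 _ _ _) (by simp [rrTerm]) fun n => ?_
  have h1 : rrPoch q j (n + 1) * (1 - q ^ (n + 1)) = rrPoch q j n * (1 - q ^ (n + 1 + j)) := by
    rw [← rrPoch_succ_left, rrPoch_succ]
  simp only [rrTerm, rrPoch_succ, rrExp_succ]
  rw [mul_assoc _ (rrPoch q j (n + 1)), h1]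
  ring

lemma abs_rrSeries_le {q : ℝ} (hq0 : 0 ≤ q) (hq1 : q < 1) (j : ℕ) :
    |rrSeries q j| ≤ (1 - q)⁻¹ := by
  rw [← Real.norm_eq_abs]
  exact tsum_of_norm_bounded (hasSum_geometric_of_lt_one hq0 hq1)
    fun n => abs_rrTerm_le hq0 hq1.le j _ _ n

lemma rrSeries_zero_pos {q : ℝ} (hq0 : 0 ≤ q) (hq1 : q < 1 / 4) : 0 < rrSeries q 0 := by
  have hs := summable_rrTerm hq0 (by linarith : q < 1) 0 (2 * 0) (fun n => 2 * (0 + 1 + 2 * n))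
  have h0 : rrTerm q 0 (2 * 0) (2 * (0 + 1 + 2 * 0)) 0 = 1 - q ^ 2 := by
    simp [rrTerm, rrExp, rrPoch]
  have h1 : |∑' n, rrTerm q 0 (2 * 0) (2 * (0 + 1 + 2 * (n + 1))) (n + 1)| ≤ (1 - q)⁻¹ * q := by
    rw [← Real.norm_eq_abs]
    exact tsum_of_norm_bounded ((hasSum_geometric_of_lt_one hq0 (by linarith)).mul_right q)
      fun n => (abs_rrTerm_le hq0 (by linarith) _ _ _ _).trans_eq (pow_succ _ _)
  have h2 : (1 - q)⁻¹ * q ≤ 1 / 3 := by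
    rw [inv_mul_le_iff₀ (by linarith)]; linarith
  rw [rrSeries, hs.tsum_eq_zero_add, h0]
  nlinarith [neg_abs_le (∑' n, rrTerm q 0 (2 * 0) (2 * (0 + 1 + 2 * (n + 1))) (n + 1))]

lemma rrCFa_succ (k : ℕ) : rrCFa (k + 1) = Real.exp (-2 * π) ^ k := by
  rw [← Real.exp_nat_mul, rrCFa]
  split_ifs with h
  · obtain rfl : k = 0 := by omega
    simp
  · congr 1
    push_cast
    ring

lemma rrCFNum_invariant {F : ℕ → ℝ}
    (hF : ∀ j, F j = F (j + 1) + Real.exp (-2 * π) ^ (j + 1) * F (j + 2)) (n : ℕ) :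
    rrCFNum (n + 1) * F n + Real.exp (-2 * π) ^ n * rrCFNum n * F (n + 1) = F 1 := by
  induction n with
  | zero => simp [rrCFNum]
  | succ n ih =>
    rw [← ih, rrCFNum, rrCFa_succ, hF n]
    ring

lemma rrCFDen_invariant {F : ℕ → ℝ}
    (hF : ∀ j, F j = F (j + 1) + Real.exp (-2 * π) ^ (j + 1) * F (j + 2)) (n : ℕ) :
    rrCFDen (n + 1) * F n + Real.exp (-2 * π) ^ n * rrCFDen n * F (n + 1) = F 0 := by
  induction n with
  | zero => simp [rrCFDen]
  | succ n ih =>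
    rw [← ih, rrCFDen, rrCFa_succ, hF n]
    ring

lemma rrCFDen_bounds (n : ℕ) : 0 ≤ rrCFDen n ∧ 1 ≤ rrCFDen (n + 1) := by
  induction n with
  | zero => simp [rrCFDen]
  | succ n ih =>
    refine ⟨by linarith [ih.2], ?_⟩
    rw [rrCFDen, rrCFa_succ]
    nlinarith [mul_nonneg (pow_nonneg (Real.exp_pos (-2 * π)).le n) ih.1]

lemma abs_rrCF_det_le (n : ℕ) :
    |rrCFNum n * rrCFDen (n + 1) - rrCFNum (n + 1) * rrCFDen n| ≤ 1 := by
  induction n with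
  | zero => simp [rrCFDen, rrCFNum]
  | succ n ih =>
    have h : rrCFNum (n + 1) * rrCFDen (n + 2) - rrCFNum (n + 2) * rrCFDen (n + 1) =
        -(Real.exp (-2 * π) ^ n *
          (rrCFNum n * rrCFDen (n + 1) - rrCFNum (n + 1) * rrCFDen n)) := by
      rw [rrCFDen, rrCFNum, rrCFa_succ]
      ring
    rw [h, abs_neg, abs_mul, abs_of_nonneg (by positivity)]
    exact mul_le_one₀ (pow_le_one₀ (Real.exp_pos _).le
      (Real.exp_le_one_iff.2 (by linarith [Real.pi_pos]))) (abs_nonneg _) ih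

lemma tendsto_rrCF_of_recurrence {F : ℕ → ℝ} {C : ℝ}
    (hF : ∀ j, F j = F (j + 1) + Real.exp (-2 * π) ^ (j + 1) * F (j + 2))
    (hC : ∀ j, |F j| ≤ C) (h0 : F 0 ≠ 0) :
    Tendsto (fun k : ℕ => rrCFNum (k + 1) / rrCFDen (k + 1)) atTop (nhds (F 1 / F 0)) := by
  have hq : Real.exp (-2 * π) < 1 := Real.exp_lt_one_iff.2 (by linarith [Real.pi_pos])
  rw [tendsto_iff_norm_sub_tendsto_zero]
  refine squeeze_zero (fun _ => norm_nonneg _) (g := fun n => Real.exp (-2 * π) ^ n * (C / |F 0|))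
    (fun n => ?_) (by simpa using (tendsto_pow_atTop_nhds_zero_of_lt_one
      (Real.exp_pos _).le hq).mul_const (C / |F 0|))
  have hD := (rrCFDen_bounds n).2
  have hD0 : rrCFDen (n + 1) ≠ 0 := by linarith
  have key : rrCFNum (n + 1) / rrCFDen (n + 1) - F 1 / F 0 = -(Real.exp (-2 * π) ^ n *
      (F (n + 1) * (rrCFNum n * rrCFDen (n + 1) - rrCFNum (n + 1) * rrCFDen n)) /
        (rrCFDen (n + 1) * F 0)) := by
    rw [div_sub_div _ _ hD0 h0, ← neg_div]
    congr 1
    linear_combination rrCFDen (n + 1) * rrCFNum_invariant hF n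
      - rrCFNum (n + 1) * rrCFDen_invariant hF n
  rw [key, Real.norm_eq_abs, abs_neg, abs_div, abs_mul, abs_mul, abs_mul,
    abs_of_nonneg (by positivity : 0 ≤ Real.exp (-2 * π) ^ n),
    abs_of_pos (by linarith : 0 < rrCFDen (n + 1)),
    mul_div_assoc]
  have hC0 : 0 ≤ C := (abs_nonneg _).trans (hC 0)
  have h00 : 0 < |F 0| := abs_pos.2 h0
  gcongr
  · calc _ ≤ C * 1 := mul_le_mul (hC _) (abs_rrCF_det_le n) (abs_nonneg _) hC0
      _ = C := mul_one _
  · exact le_mul_of_one_le_left h00.le hD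

lemma jacobiTheta₂_eq_sum_five (z : ℂ) {τ : ℂ} (hτ : 0 < τ.im) :
    jacobiTheta₂ z τ = ∑ r : Fin 5,
      Complex.exp (2 * π * Complex.I * (r : ℕ) * z + π * Complex.I * (r : ℕ) ^ 2 * τ) *
        jacobiTheta₂ (5 * z + 5 * (r : ℕ) * τ) (25 * τ) := by
  let e : Fin 5 × ℤ ≃ ℤ := (Equiv.prodComm _ _).trans (Int.divModEquiv 5).symm
  have hs : Summable fun p : Fin 5 × ℤ => jacobiTheta₂_term (e p) z τ :=
    e.summable_iff.2 ((summable_jacobiTheta₂_term_iff z τ).2 hτ)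
  rw [jacobiTheta₂, ← e.tsum_eq, hs.tsum_prod, tsum_fintype]
  refine Finset.sum_congr rfl fun r _ => ?_
  rw [jacobiTheta₂, ← tsum_mul_left]
  refine tsum_congr fun n => ?_
  simp only [jacobiTheta₂_term, ← Complex.exp_add]
  congr 1
  simp only [e, Equiv.trans_apply, Equiv.prodComm_apply, Prod.swap_prod_mk,
    Int.divModEquiv_symm_apply]
  push_cast
  ring

lemma jacobiTheta₂_half_add_half_self (τ : ℂ) : jacobiTheta₂ (1 / 2 + τ / 2) τ = 0 := by
  have h := jacobiTheta₂_add_left' (1 / 2 - τ / 2) τ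
  have h1 : jacobiTheta₂ (1 / 2 - τ / 2) τ = jacobiTheta₂ (1 / 2 + τ / 2) τ := by
    rw [← jacobiTheta₂_neg_left, ← jacobiTheta₂_add_left]
    congr 1
    ring
  have h2 : Complex.exp (-π * Complex.I * (τ + 2 * (1 / 2 - τ / 2))) = -1 := by
    rw [show -π * Complex.I * (τ + 2 * (1 / 2 - τ / 2)) = -(π * Complex.I) by ring,
      Complex.exp_neg, Complex.exp_pi_mul_I]
    norm_num
  rw [h1, h2, show 1 / 2 - τ / 2 + τ = 1 / 2 + τ / 2 by ring] at h
  linear_combination h / 2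

lemma jacobiTheta₂_term_half (b : ℝ) (m : ℤ) :
    jacobiTheta₂_term m (1 / 2 + b / 2 * Complex.I) (5 * Complex.I) =
      (((-1) ^ m * Real.exp (-π * (b * m + 5 * m ^ 2)) : ℝ) : ℂ) := by
  rw [jacobiTheta₂_term]
  push_cast
  rw [← Complex.exp_pi_mul_I, ← Complex.exp_int_mul, ← Complex.exp_add]
  congr 1
  linear_combination (π * b * m + 5 * π * m ^ 2 : ℂ) * Complex.I_sq

lemma hasSum_jacobiTheta₂_half (b : ℝ) :
    HasSum (fun n : ℕ => (((-1) ^ n * (Real.exp (-π * (b * n + 5 * n ^ 2)) *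
      (1 - Real.exp (-π * ((5 - b) * (2 * n + 1))))) : ℝ) : ℂ))
      (jacobiTheta₂ (1 / 2 + b / 2 * Complex.I) (5 * Complex.I)) := by
  have h := (hasSum_jacobiTheta₂_term (1 / 2 + b / 2 * Complex.I)
    (τ := 5 * Complex.I) (by simp)).nat_add_neg_add_one
  convert h using 2 with n
  rw [jacobiTheta₂_term_half, jacobiTheta₂_term_half, ← Complex.ofReal_add]
  congr 1
  rw [mul_sub, ← Real.exp_add, zpow_neg, zpow_add_one₀ (by norm_num), zpow_natCast, mul_inv,
    ← inv_pow, show ((-1 : ℝ))⁻¹ = -1 by norm_num]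
  push_cast
  rw [show -π * (b * n + 5 * n ^ 2) + -π * ((5 - b) * (2 * n + 1)) =
    -π * (b * -(n + 1) + 5 * (-(n + 1)) ^ 2) by ring]
  ring

lemma jacobiTheta₂_half_eq_rrSeries_zero :
    jacobiTheta₂ (1 / 2 + 1 / 2 * Complex.I) (5 * Complex.I) =
      (rrSeries (Real.exp (-2 * π)) 0 : ℂ) := by
  have h := hasSum_jacobiTheta₂_half 1
  rw [Complex.ofReal_one] at h
  rw [← h.tsum_eq, ← Complex.ofReal_tsum, rrSeries]
  congr 1
  refine tsum_congr fun n => ?_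
  simp only [rrTerm, rrPoch, Finset.prod_range_zero, ← Real.exp_nat_mul]
  rw [mul_one, mul_assoc,
    show -π * (1 * n + 5 * n ^ 2) = (rrExp n + (2 * 0) * n : ℕ) * (-2 * π) by
      push_cast; linear_combination π * two_mul_rrExp n,
    show -π * ((5 - 1) * (2 * n + 1)) = (2 * (0 + 1 + 2 * n) : ℕ) * (-2 * π) by
      push_cast; ring]

lemma jacobiTheta₂_half_eq_rrSeries_one :
    jacobiTheta₂ (1 / 2 + 3 / 2 * Complex.I) (5 * Complex.I) =
      (rrSeries (Real.exp (-2 * π)) 1 : ℂ) := by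
  have h := hasSum_jacobiTheta₂_half 3
  rw [Complex.ofReal_ofNat] at h
  rw [← h.tsum_eq, ← Complex.ofReal_tsum,
    rrSeries_succ (Real.exp_pos _).le (Real.exp_lt_one_iff.2 (by linarith [Real.pi_pos])) 0]
  congr 1
  refine tsum_congr fun n => ?_
  simp only [rrTerm, rrPoch, Finset.prod_range_zero, ← Real.exp_nat_mul]
  rw [mul_one, mul_assoc,
    show -π * (3 * n + 5 * n ^ 2) = (rrExp n + (2 * 0 + 1) * n : ℕ) * (-2 * π) by
      push_cast; linear_combination π * two_mul_rrExp n,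
    show -π * ((5 - 3) * (2 * n + 1)) = (0 + 1 + 2 * n : ℕ) * (-2 * π) by
      push_cast; ring]

lemma jacobiTheta₂_tenth_eq :
    jacobiTheta₂ (1 / 10 - 1 / 10 * Complex.I) (1 / 5 * Complex.I) =
      (1 + Complex.exp (π / 5 * Complex.I)) *
          jacobiTheta₂ (1 / 2 + 1 / 2 * Complex.I) (5 * Complex.I) +
        (Complex.exp (-(2 * π / 5) + 2 * π / 5 * Complex.I) +
            Complex.exp (-(2 * π / 5) - π / 5 * Complex.I)) *
          jacobiTheta₂ (1 / 2 + 3 / 2 * Complex.I) (5 * Complex.I) := by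
  have reflect (b : ℂ) : jacobiTheta₂ (1 / 2 - b * Complex.I) (5 * Complex.I) =
      jacobiTheta₂ (1 / 2 + b * Complex.I) (5 * Complex.I) := by
    rw [← jacobiTheta₂_neg_left, ← jacobiTheta₂_add_left]
    ring_nf
  have t3 : jacobiTheta₂ (1 / 2 + 5 / 2 * Complex.I) (5 * Complex.I) = 0 := by
    rw [show 5 / 2 * Complex.I = 5 * Complex.I / 2 by ring, jacobiTheta₂_half_add_half_self]
  have t4 : jacobiTheta₂ (1 / 2 + 7 / 2 * Complex.I) (5 * Complex.I) =
      Complex.exp (2 * π - π * Complex.I) *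
        jacobiTheta₂ (1 / 2 + 3 / 2 * Complex.I) (5 * Complex.I) := by
    rw [← reflect (3 / 2), show (1 / 2 + 7 / 2 * Complex.I : ℂ) =
      1 / 2 - 3 / 2 * Complex.I + 5 * Complex.I by ring, jacobiTheta₂_add_left']
    congr 2
    linear_combination (-2 * π) * Complex.I_sq
  have arg (r : ℂ) : 5 * (1 / 10 - 1 / 10 * Complex.I) + 5 * r * (1 / 5 * Complex.I) =
      1 / 2 + (r - 1 / 2) * Complex.I := by ring
  have expo (r : ℂ) : 2 * π * Complex.I * r * (1 / 10 - 1 / 10 * Complex.I) +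
      π * Complex.I * r ^ 2 * (1 / 5 * Complex.I) =
        π / 5 * (r - r ^ 2) + π / 5 * r * Complex.I := by
    linear_combination (π / 5 * (r ^ 2 - r)) * Complex.I_sq
  rw [jacobiTheta₂_eq_sum_five _ (by simp)]
  simp only [arg, expo, Fin.sum_univ_five, show 25 * (1 / 5 * Complex.I) = 5 * Complex.I by ring]
  have v2 : ((2 : Fin 5) : ℕ) = 2 := rfl
  have v3 : ((3 : Fin 5) : ℕ) = 3 := rfl
  have v4 : ((4 : Fin 5) : ℕ) = 4 := rfl
  simp only [Fin.val_zero, Fin.val_one, v2, v3, v4, Nat.cast_zero, Nat.cast_one, Nat.cast_ofNat]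
  rw [show (0 - 1 / 2 : ℂ) * Complex.I = -(1 / 2 * Complex.I) by ring, ← sub_eq_add_neg, reflect,
    show (1 - 1 / 2 : ℂ) = 1 / 2 by norm_num, show (2 - 1 / 2 : ℂ) = 3 / 2 by norm_num,
    show (3 - 1 / 2 : ℂ) = 5 / 2 by norm_num, show (4 - 1 / 2 : ℂ) = 7 / 2 by norm_num, t3, t4,
    ← mul_assoc (Complex.exp _) (Complex.exp _), ← Complex.exp_add,
    show (π / 5 * (0 - 0 ^ 2) + π / 5 * 0 * Complex.I : ℂ) = 0 by ring, Complex.exp_zero,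
    show (π / 5 * (1 - 1 ^ 2) + π / 5 * 1 * Complex.I : ℂ) = π / 5 * Complex.I by ring,
    show (π / 5 * (2 - 2 ^ 2) + π / 5 * 2 * Complex.I : ℂ) =
      -(2 * π / 5) + 2 * π / 5 * Complex.I by ring,
    show (π / 5 * (4 - 4 ^ 2) + π / 5 * 4 * Complex.I + (2 * π - π * Complex.I) : ℂ) =
      -(2 * π / 5) - π / 5 * Complex.I by ring]
  ring

lemma sqrt_five_mul_rrSeries_zero :
    √5 * rrSeries (Real.exp (-2 * π)) 0 =
      2 * Real.cos (π / 10) * rrSeries (Real.exp (-2 * π)) 0 +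
        2 * Real.cos (3 * (π / 10)) *
          (Real.exp (-(2 * π / 5)) * rrSeries (Real.exp (-2 * π)) 1) := by
  have hsqrt : (-Complex.I * (5 * Complex.I)) ^ (1 / 2 : ℂ) = (√5 : ℂ) := by
    rw [show -Complex.I * (5 * Complex.I) = ((5 : ℝ) : ℂ) by
      push_cast; linear_combination (-5) * Complex.I_sq, Real.sqrt_eq_rpow,
      Complex.ofReal_cpow (by norm_num)]
    norm_num
  have h := jacobiTheta₂_functional_equation (1 / 2 + 1 / 2 * Complex.I) (5 * Complex.I)
  have hz : (1 / 2 + 1 / 2 * Complex.I) / (5 * Complex.I) = 1 / 10 - 1 / 10 * Complex.I := by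
    rw [div_eq_iff (by simp)]
    linear_combination (1 / 2) * Complex.I_sq
  have hτ : -1 / (5 * Complex.I) = 1 / 5 * Complex.I := by
    rw [div_eq_iff (by simp)]
    linear_combination -Complex.I_sq
  have he : -π * Complex.I * (1 / 2 + 1 / 2 * Complex.I) ^ 2 / (5 * Complex.I) =
      -(π / 10 : ℂ) * Complex.I := by
    rw [div_eq_iff (by simp)]
    linear_combination (-π / 4 * Complex.I) * Complex.I_sq
  rw [hsqrt, hz, hτ, he, jacobiTheta₂_tenth_eq, jacobiTheta₂_half_eq_rrSeries_zero,
    jacobiTheta₂_half_eq_rrSeries_one] at h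
  have h5 : (√5 : ℂ) ≠ 0 := by simp
  rw [one_div, mul_assoc, ← div_eq_inv_mul, eq_div_iff h5] at h
  rw [← Complex.ofReal_inj]
  push_cast
  rw [Complex.two_cos, Complex.two_cos, mul_comm, h, mul_add, ← mul_assoc, ← mul_assoc, mul_add,
    mul_add, ← mul_assoc (_ + _), add_mul (Complex.exp (3 * (π / 10) * Complex.I))]
  simp only [← Complex.exp_add]
  ring_nf

lemma exp_neg_two_pi_lt : Real.exp (-2 * π) < 1 / 4 := by
  rw [show -2 * π = -(2 * π) by ring, Real.exp_neg, one_div,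
    inv_lt_inv₀ (Real.exp_pos _) (by norm_num)]
  linarith [Real.add_one_le_exp (2 * π), Real.pi_gt_three]

lemma rrSeries_one_div_rrSeries_zero :
    rrSeries (Real.exp (-2 * π)) 1 / rrSeries (Real.exp (-2 * π)) 0 =
      (√((5 + √5) / 2) - (√5 + 1) / 2) * Real.exp (2 * π / 5) := by
  have h0 := rrSeries_zero_pos (Real.exp_pos (-2 * π)).le exp_neg_two_pi_lt
  rw [div_eq_iff h0.ne']
  have key := sqrt_five_mul_rrSeries_zero
  rw [Real.cos_three_mul] at key
  have h5 : √5 ^ 2 = 5 := Real.sq_sqrt (by norm_num)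
  have hs : √((5 + √5) / 2) ^ 2 = (5 + √5) / 2 := Real.sq_sqrt (by positivity)
  have hs0 : 0 < √((5 + √5) / 2) := Real.sqrt_pos.2 (by positivity)
  have hc : Real.cos (π / 10) = √((5 + √5) / 2) / 2 := by
    rw [show π / 10 = π / 5 / 2 by ring, Real.cos_half (by linarith [Real.pi_pos])
      (by linarith [Real.pi_pos]), Real.cos_pi_div_five,
      show (1 + (1 + √5) / 4) / 2 = (5 + √5) / 2 / 2 ^ 2 by ring,
      Real.sqrt_div (by positivity), Real.sqrt_sq (by norm_num)]
  rw [hc] at key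
  have hE : Real.exp (2 * π / 5) * Real.exp (-(2 * π / 5)) = 1 := by
    rw [← Real.exp_add, add_neg_cancel, Real.exp_zero]
  generalize √((5 + √5) / 2) = s at *
  generalize √5 = r at *
  generalize Real.exp (2 * π / 5) = E at *
  generalize Real.exp (-(2 * π / 5)) = E' at *
  generalize rrSeries (Real.exp (-2 * π)) 0 = G at *
  generalize rrSeries (Real.exp (-2 * π)) 1 = H at *
  have hr1 : r - 1 ≠ 0 := by
    intro hr
    rw [sub_eq_zero.1 hr] at h5
    norm_num at h5
  have key2 : s * (r - 1) * (E' * H - (s - (r + 1) / 2) * G) = 0 := by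
    linear_combination (-2) * key - (2 * s * E' * H + (r - 1) * G) * hs + G * (s - 1) / 2 * h5
  have key3 : E' * H = (s - (r + 1) / 2) * G := by
    rcases mul_eq_zero.1 key2 with h | h
    · exact absurd h (mul_ne_zero hs0.ne' hr1)
    · linarith
  linear_combination E * key3 - H * hE

/-- Ramanujan's evaluation of the Rogers–Ramanujan continued fraction at
`q = e^{-2π}`: the convergents of
`1/(1 + e^{-2π}/(1 + e^{-4π}/(1 + ⋯)))` converge to
`(√((5 + √5)/2) − (√5 + 1)/2) · e^{2π/5}`. -/
theorem rogers_ramanujan_continued_fraction_at_exp_neg_two_pi :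
    Tendsto (fun k : ℕ => rrCFNum (k + 1) / rrCFDen (k + 1)) atTop
      (nhds ((Real.sqrt ((5 + Real.sqrt 5) / 2) - (Real.sqrt 5 + 1) / 2) *
        Real.exp (2 * π / 5))) := by
  have hq1 : Real.exp (-2 * π) < 1 := Real.exp_lt_one_iff.2 (by linarith [Real.pi_pos])
  rw [← rrSeries_one_div_rrSeries_zero]
  exact tendsto_rrCF_of_recurrence (rrSeries_eq_add (Real.exp_pos _).le hq1)
    (abs_rrSeries_le (Real.exp_pos _).le hq1)
    (rrSeries_zero_pos (Real.exp_pos _).le exp_neg_two_pi_lt).ne'
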